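/- Let d be a real number with 0 ≤ d < 1/2. Then the iterated integral ∫₀¹∫₀^{y₁}∫₀^{y₂}∫₀^{y₃}∫₀^{y₄} (y₁−y₂)^(−d)(y₁−y₃)^(−d)(y₂−y₄)^(−d)(y₃−y₅)^(−d)(y₄−y₅)^(−d) dy₅ dy₄ dy₃ dy₂ dy₁ equals (Γ(1−d)³/((1−d)Γ(2−2d)))·(Γ(4−5d)/Γ(4−4d))·(Γ(3−3d)/Γ(6−5d))·₃F₂(d, 1−d, 3−3d; 2−d, 4−4d; 1) − (Γ(1−d)²/(1−d))·(Γ(4−5d)·Γ(2−2d)/(Γ(6−5d)·Γ(4−4d)))·₃F₂(d, 1−d, 2−2d; 2−d, 4−4d; 1). -/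

import Mathlib

open Real

noncomputable def poch (a : ℝ) (k : ℕ) : ℝ := ∏ i ∈ Finset.range k, (a + i)

noncomputable def F21 (a b c x : ℝ) : ℝ :=
  ∑' k : ℕ, poch a k * poch b k / (poch c k * (Nat.factorial k : ℝ)) * x ^ k

noncomputable def F32 (a b c e f : ℝ) : ℝ :=
  ∑' k : ℕ, poch a k * poch b k * poch c k / (poch e k * poch f k * (Nat.factorial k : ℝ))

noncomputable def F32x (a b c e f x : ℝ) : ℝ :=
  ∑' k : ℕ, poch a k * poch b k * poch c k / (poch e k * poch f k * (Nat.factorial k : ℝ)) * x ^ k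

noncomputable def F43 (a b c g e f h : ℝ) : ℝ :=
  ∑' k : ℕ, poch a k * poch b k * poch c k * poch g k /
    (poch e k * poch f k * poch h k * (Nat.factorial k : ℝ))

open MeasureTheory Set

noncomputable def pw (a t : ℝ) : ENNReal := if 0 < t then ENNReal.ofReal (t ^ a) else 0

lemma pw_of_pos {a t : ℝ} (h : 0 < t) : pw a t = ENNReal.ofReal (t ^ a) := by simp [pw, h]
lemma pw_of_nonpos {a t : ℝ} (h : t ≤ 0) : pw a t = 0 := by simp [pw, h]
lemma pw_ne_top (a t : ℝ) : pw a t ≠ ⊤ := by unfold pw; split_ifs <;> simp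

lemma pw_mul (a b t : ℝ) : pw a t * pw b t = pw (a + b) t := by
  by_cases h : 0 < t
  · rw [pw_of_pos h, pw_of_pos h, pw_of_pos h, ← ENNReal.ofReal_mul (by positivity),
      Real.rpow_add h]
  · simp [pw_of_nonpos (not_lt.mp h)]

lemma pw_scale (a : ℝ) {s : ℝ} (hs : 0 < s) (t : ℝ) :
    pw a (s * t) = pw a s * pw a t := by
  by_cases h : 0 < t
  · rw [pw_of_pos h, pw_of_pos hs, pw_of_pos (by positivity), ← ENNReal.ofReal_mul (by positivity),
      Real.mul_rpow hs.le h.le]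
  · have : s * t ≤ 0 := mul_nonpos_of_nonneg_of_nonpos hs.le (not_lt.mp h)
    simp [pw_of_nonpos (not_lt.mp h), pw_of_nonpos this]

lemma measurable_pw (a : ℝ) : Measurable (pw a) := by
  unfold pw
  refine Measurable.ite (measurableSet_lt measurable_const measurable_id) ?_ measurable_const
  fun_prop

@[fun_prop]
lemma Measurable.pw {α : Type*} [MeasurableSpace α] {f : α → ℝ} (a : ℝ) (hf : Measurable f) :
    Measurable (fun x => pw a (f x)) := (measurable_pw a).comp hf

lemma lint_affine (f : ℝ → ENNReal) (hf : Measurable f) (a : ℝ) {s : ℝ} (hs : 0 < s) :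
    ∫⁻ x, f x = ENNReal.ofReal s * ∫⁻ x, f (a + s * x) := by
  rw [← lintegral_add_left_eq_self f a]
  conv_lhs => rw [← Real.smul_map_volume_mul_left hs.ne']
  rw [lintegral_smul_measure, lintegral_map (by fun_prop) (by fun_prop), abs_of_pos hs]
  rfl

lemma lint_beta {a b : ℝ} (ha : -1 < a) (hb : -1 < b) :
    ∫⁻ t, pw a t * pw b (1 - t) = ENNReal.ofReal (ProbabilityTheory.beta (a+1) (b+1)) := by
  have hB := ProbabilityTheory.beta_pos (α := a+1) (β := b+1) (by linarith) (by linarith)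
  have h := ProbabilityTheory.lintegral_betaPDF_eq_one (α := a+1) (β := b+1)
    (by linarith) (by linarith)
  have e : ∀ t, pw a t * pw b (1 - t) = ENNReal.ofReal (ProbabilityTheory.beta (a+1) (b+1)) *
      ProbabilityTheory.betaPDF (a+1) (b+1) t := by
    intro t
    by_cases h0 : 0 < t
    · by_cases h1 : t < 1
      · have : 0 < 1 - t := by linarith
        rw [pw_of_pos h0, pw_of_pos this, ProbabilityTheory.betaPDF_of_pos_lt_one h0 h1,
          ← ENNReal.ofReal_mul (by positivity), ← ENNReal.ofReal_mul hB.le]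
        congr 1
        simp only [add_sub_cancel_right]
        field_simp
      · rw [pw_of_nonpos (t := 1 - t) (by linarith),
          ProbabilityTheory.betaPDF_eq_zero_of_one_le (by linarith)]; simp
    · rw [pw_of_nonpos (not_lt.mp h0),
          ProbabilityTheory.betaPDF_eq_zero_of_nonpos (by linarith)]; simp
  simp_rw [e]
  rw [lintegral_const_mul', h, mul_one]
  simp

lemma lint_conv {a b : ℝ} (ha : -1 < a) (hb : -1 < b) (u v : ℝ) :
    ∫⁻ t, pw a (t - u) * pw b (v - t) =
      ENNReal.ofReal (ProbabilityTheory.beta (a+1) (b+1)) * pw (a + b + 1) (v - u) := by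
  by_cases h : 0 < v - u
  · rw [lint_affine _ (by fun_prop) u h]
    have e : ∀ x, pw a (u + (v - u) * x - u) * pw b (v - (u + (v - u) * x)) =
        (pw a (v - u) * pw b (v - u)) * (pw a x * pw b (1 - x)) := by
      intro x
      rw [show u + (v - u) * x - u = (v - u) * x by ring,
        show v - (u + (v - u) * x) = (v - u) * (1 - x) by ring, pw_scale _ h, pw_scale _ h]
      ring
    simp_rw [e]
    rw [lintegral_const_mul' _ _ (ENNReal.mul_ne_top (pw_ne_top _ _) (pw_ne_top _ _)),
      lint_beta ha hb, pw_mul, ← mul_assoc, ← pw_mul (a+b) 1, pw_of_pos (a := 1) h, Real.rpow_one]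
    ring
  · rw [pw_of_nonpos (not_lt.mp h), mul_zero]
    rw [← lintegral_zero (μ := (volume : Measure ℝ))]
    congr 1; ext t
    by_cases h' : 0 < t - u
    · rw [pw_of_nonpos (t := v - t) (by linarith), mul_zero]
    · rw [pw_of_nonpos (not_lt.mp h'), zero_mul]

lemma poch_nonneg {a : ℝ} (ha : 0 ≤ a) (k : ℕ) : 0 ≤ poch a k :=
  Finset.prod_nonneg fun i _ => by positivity

lemma poch_pos {a : ℝ} (ha : 0 < a) (k : ℕ) : 0 < poch a k :=
  Finset.prod_pos fun i _ => by positivity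

lemma poch_eq_eval (a : ℝ) (k : ℕ) : poch a k = (ascPochhammer ℝ k).eval a := by
  induction k with
  | zero => simp [poch]
  | succ k ih =>
    rw [ascPochhammer_succ_eval, ← ih]; simp [poch, Finset.prod_range_succ]

lemma gamma_add_nat {a : ℝ} (ha : 0 < a) (k : ℕ) : Gamma (a + k) = poch a k * Gamma a := by
  induction k with
  | zero => simp [poch]
  | succ k ih =>
    push_cast
    rw [← add_assoc, Real.Gamma_add_one (by positivity), ih]
    simp [poch, Finset.prod_range_succ]; ring

lemma choose_eq (a : ℝ) (n : ℕ) : Ring.choose (a + n - 1) n = poch a n / (n.factorial : ℝ) := by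
  have : Ring.choose (a + n - 1) n = Ring.multichoose a n := by
    unfold Ring.choose; congr 1; ring
  rw [this, poch_eq_eval, ← Polynomial.ascPochhammer_smeval_eq_eval,
    ← Ring.factorial_nsmul_multichoose_eq_ascPochhammer, nsmul_eq_mul]
  have : (n.factorial : ℝ) ≠ 0 := by positivity
  field_simp

lemma binom (d : ℝ) {x : ℝ} (hx0 : 0 ≤ x) (hx : x < 1) :
    HasSum (fun n : ℕ => poch d n / (n.factorial : ℝ) * x ^ n) ((1 - x) ^ (-d)) := by
  have h := (Real.one_div_one_sub_rpow_hasFPowerSeriesOnBall_zero d).hasSum (y := x)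
    (by rw [Metric.mem_eball, edist_zero_right, Real.enorm_eq_ofReal hx0]; simpa using hx)
  simp only [zero_add, FormalMultilinearSeries.ofScalars_apply_eq, choose_eq, smul_eq_mul] at h
  rw [Real.rpow_neg (by linarith), ← one_div]
  exact h

lemma pw_series {d : ℝ} (hd : 0 ≤ d) {x : ℝ} (hx0 : 0 < x) (hx : x < 1) :
    pw (-d) (1 - x) = ∑' n : ℕ, ENNReal.ofReal (poch d n / (n.factorial : ℝ)) * pw n x := by
  have h := binom d hx0.le hx
  have hp : ∀ n : ℕ, 0 ≤ poch d n / (n.factorial : ℝ) := fun n =>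
    div_nonneg (poch_nonneg hd n) (by positivity)
  rw [pw_of_pos (by linarith), ← h.tsum_eq, ENNReal.ofReal_tsum_of_nonneg _ h.summable]
  · congr 1; ext n
    rw [ENNReal.ofReal_mul (hp n), pw_of_pos hx0, Real.rpow_natCast]
  · intro n; exact mul_nonneg (hp n) (by positivity)

lemma step {y : ℝ} (hy : 0 ≤ y) {F : ℝ → ENNReal} (hm : Measurable F)
    (hz : ∀ x, x ∉ Ioo 0 y → F x = 0) (hfin : ∫⁻ x, F x ≠ ⊤) {f : ℝ → ℝ}
    (hf : ∀ x ∈ Ioo 0 y, F x ≠ ⊤ → f x = (F x).toReal) :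
    ∫ x in (0:ℝ)..y, f x = (∫⁻ x, F x).toReal := by
  have hF : ∫⁻ x, F x = ∫⁻ x in Ioo 0 y, F x := by
    rw [← lintegral_indicator measurableSet_Ioo]
    congr 1; ext x
    by_cases hx : x ∈ Ioo 0 y
    · simp [hx]
    · rw [indicator_of_notMem hx, hz x hx]
  rw [intervalIntegral.integral_of_le hy, integral_Ioc_eq_integral_Ioo]
  rw [hF] at hfin ⊢
  have hae : ∀ᵐ x ∂(volume.restrict (Ioo 0 y)), F x < ⊤ := ae_lt_top hm hfin
  rw [← integral_toReal hm.aemeasurable hae]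
  apply integral_congr_ae
  filter_upwards [hae, ae_restrict_mem measurableSet_Ioo] with x hx hx'
  exact hf x hx' hx.ne

open ProbabilityTheory in
lemma beta_one {a : ℝ} (ha : 0 < a) : beta a 1 = 1 / a := by
  have := (Real.Gamma_pos_of_pos ha).ne'
  rw [beta, Real.Gamma_add_one ha.ne', Real.Gamma_one]; field_simp

open ProbabilityTheory in
lemma beta_one_left {a : ℝ} (ha : 0 < a) : beta 1 a = 1 / a := by
  have := (Real.Gamma_pos_of_pos ha).ne'
  rw [beta, add_comm, Real.Gamma_add_one ha.ne', Real.Gamma_one]; field_simp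

lemma poch_ratio (a : ℝ) (k : ℕ) : poch a k * (a + k) = a * poch (a + 1) k := by
  have h1 : poch a (k+1) = poch a k * (a + k) := by simp [poch, Finset.prod_range_succ]
  rw [← h1, poch, Finset.prod_range_succ', poch, mul_comm]
  simp only [Nat.cast_zero, add_zero]
  congr 1
  apply Finset.prod_congr rfl
  intro i _; push_cast; ring

noncomputable def bt (d x : ℝ) : ENNReal := ∫⁻ t, pw (-d) t * pw (-d) (1 - t) * pw 0 (x - t)

lemma measurable_bt (d : ℝ) : Measurable (bt d) := by
  unfold bt
  fun_prop

@[fun_prop]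
lemma Measurable.bt {α : Type*} [MeasurableSpace α] {f : α → ℝ} (a : ℝ) (hf : Measurable f) :
    Measurable (fun x => bt a (f x)) := (measurable_bt a).comp hf

lemma pw_zero_le (t : ℝ) : pw 0 t ≤ 1 := by unfold pw; split_ifs <;> simp

lemma bt_le {d : ℝ} (h1 : d < 1/2) (x : ℝ) :
    bt d x ≤ ENNReal.ofReal (ProbabilityTheory.beta (-d+1) (-d+1)) := by
  rw [← lint_beta (by linarith) (by linarith)]
  apply lintegral_mono
  intro t
  exact mul_le_of_le_one_right' (pw_zero_le _)

lemma bt_series {d : ℝ} (h0 : 0 ≤ d) (h1 : d < 1/2) {x : ℝ} (hx : x ≤ 1) :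
    bt d x = ∑' k : ℕ, ENNReal.ofReal (poch d k / (k.factorial : ℝ) * (1 / (k + 1 - d))) *
      pw (k + 1 - d) x := by
  have e : ∀ t, pw (-d) t * pw (-d) (1 - t) * pw 0 (x - t) =
      ∑' k : ℕ, ENNReal.ofReal (poch d k / (k.factorial : ℝ)) *
        (pw (k - d) (t - 0) * pw 0 (x - t)) := by
    intro t
    by_cases ht : 0 < t
    · by_cases ht1 : t < 1
      · rw [pw_series h0 ht ht1, ← ENNReal.tsum_mul_left, ← ENNReal.tsum_mul_right]
        congr 1; ext k
        rw [sub_zero, sub_eq_add_neg (k:ℝ) d, ← pw_mul]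
        ring
      · rw [pw_of_nonpos (t := 1 - t) (by linarith), pw_of_nonpos (t := x - t) (by linarith)]
        simp
    · simp [pw_of_nonpos (not_lt.mp ht)]
  unfold bt
  simp_rw [e]
  rw [lintegral_tsum (fun k => by fun_prop)]
  congr 1; ext k
  have hk : (0:ℝ) ≤ k := by positivity
  rw [lintegral_const_mul' _ _ (by simp), lint_conv (by linarith) (by norm_num), zero_add,
    beta_one (by linarith), ← mul_assoc, ← ENNReal.ofReal_mul
      (div_nonneg (poch_nonneg h0 k) (by positivity)), sub_zero,
    show (k:ℝ) - d + 0 + 1 = k + 1 - d by ring, show (k:ℝ) - d + 1 = k + 1 - d by ring]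

noncomputable def IA (d : ℝ) : ENNReal :=
  ∫⁻ x, ∫⁻ z, pw (-d) (1 - x) * pw (-d) (x - z) * pw (-d) z * bt d x
noncomputable def IB (d : ℝ) : ENNReal :=
  ∫⁻ x, ∫⁻ z, pw (-d) (1 - x) * pw (-d) (x - z) * pw (-d) z * bt d z

lemma bt_ne_top {d : ℝ} (h1 : d < 1/2) (x : ℝ) : bt d x ≠ ⊤ :=
  ((bt_le h1 x).trans_lt ENNReal.ofReal_lt_top).ne

lemma IA_eq {d : ℝ} (h1 : d < 1/2) : IA d = ENNReal.ofReal (ProbabilityTheory.beta (-d+1) (-d+1)) *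
    ∫⁻ x, pw (1 - 2 * d) x * pw (-d) (1 - x) * bt d x := by
  unfold IA
  rw [← lintegral_const_mul' _ _ (by simp)]
  congr 1; ext x
  have e : ∀ z, pw (-d) (1 - x) * pw (-d) (x - z) * pw (-d) z * bt d x =
      (pw (-d) (1 - x) * bt d x) * (pw (-d) (z - 0) * pw (-d) (x - z)) := by
    intro z; rw [sub_zero]; ring
  simp_rw [e]
  rw [lintegral_const_mul' _ _ (ENNReal.mul_ne_top (pw_ne_top _ _) (bt_ne_top h1 _)),
    lint_conv (by linarith) (by linarith), sub_zero, show -d + -d + 1 = 1 - 2 * d by ring]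
  ring

lemma IB_eq {d : ℝ} (h1 : d < 1/2) : IB d = ENNReal.ofReal (ProbabilityTheory.beta (-d+1) (-d+1)) *
    ∫⁻ x, pw (-d) x * pw (1 - 2 * d) (1 - x) * bt d x := by
  unfold IB
  rw [lintegral_lintegral_swap (by fun_prop)]
  rw [← lintegral_const_mul' _ _ (by simp)]
  congr 1; ext z
  have e : ∀ x, pw (-d) (1 - x) * pw (-d) (x - z) * pw (-d) z * bt d z =
      (pw (-d) z * bt d z) * (pw (-d) (x - z) * pw (-d) (1 - x)) := by
    intro z; ring
  simp_rw [e]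
  rw [lintegral_const_mul' _ _ (ENNReal.mul_ne_top (pw_ne_top _ _) (bt_ne_top h1 _)),
    lint_conv (by linarith) (by linarith), show -d + -d + 1 = 1 - 2 * d by ring]
  ring

lemma lint_bt {d a b : ℝ} (h0 : 0 ≤ d) (h1 : d < 1/2) (ha : -1 < a) (hb : -1 < b) :
    ∫⁻ x, pw a x * pw b (1 - x) * bt d x = ∑' k : ℕ,
      ENNReal.ofReal (poch d k / (k.factorial : ℝ) * (1 / (k + 1 - d)) *
        ProbabilityTheory.beta (a + 2 - d + k) (b + 1)) := by
  have e : ∀ x, pw a x * pw b (1 - x) * bt d x =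
      ∑' k : ℕ, ENNReal.ofReal (poch d k / (k.factorial : ℝ) * (1 / (k + 1 - d))) *
      (pw (a + (k + 1 - d)) x * pw b (1 - x)) := by
    intro x
    by_cases hx : x ≤ 1
    · rw [bt_series h0 h1 hx, ← ENNReal.tsum_mul_left]
      congr 1; ext k
      rw [← pw_mul]; ring
    · simp [pw_of_nonpos (t := 1 - x) (by linarith)]
  simp_rw [e]
  rw [lintegral_tsum (fun k => by fun_prop)]
  congr 1; ext k
  have hk : (0:ℝ) ≤ k := by positivity
  rw [lintegral_const_mul' _ _ (by simp), lint_beta (by linarith) hb, ← ENNReal.ofReal_mul]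
  · congr 3; ring
  · exact mul_nonneg (div_nonneg (poch_nonneg h0 k) (by positivity))
      (one_div_nonneg.mpr (by linarith))

lemma lint_bt_ne_top {d a b : ℝ} (h1 : d < 1/2) (ha : -1 < a) (hb : -1 < b) :
    ∫⁻ x, pw a x * pw b (1 - x) * bt d x ≠ ⊤ := by
  refine ((lintegral_mono (fun x => mul_le_mul_right (bt_le h1 x) _)).trans_lt ?_).ne
  rw [lintegral_mul_const' _ _ (by simp), lint_beta ha hb]
  exact ENNReal.mul_lt_top (by simp) (by simp)

lemma lint_bt_real {d a b : ℝ} (h0 : 0 ≤ d) (h1 : d < 1/2) (ha : -1 < a) (hb : -1 < b) :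
    (∫⁻ x, pw a x * pw b (1 - x) * bt d x).toReal = 1 / (1 - d) *
      (Gamma (a + 2 - d) * Gamma (b + 1) / Gamma (a + 2 - d + (b + 1))) *
      F32 d (1 - d) (a + 2 - d) (2 - d) (a + 2 - d + (b + 1)) := by
  rw [lint_bt h0 h1 ha hb, ENNReal.tsum_toReal_eq (by simp), F32, ← tsum_mul_left]
  congr 1; ext k
  have hk : (0:ℝ) ≤ k := by positivity
  have hB := ProbabilityTheory.beta_pos (α := a + 2 - d + k) (β := b + 1) (by linarith) (by linarith)
  rw [ENNReal.toReal_ofReal]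
  · rw [ProbabilityTheory.beta, show a + 2 - d + k + (b + 1) = a + 2 - d + (b + 1) + k by ring,
      gamma_add_nat (by linarith), gamma_add_nat (by linarith)]
    have hr := poch_ratio (1 - d) k
    rw [show 1 - d + 1 = 2 - d by ring] at hr
    have p1 := (poch_pos (a := 2 - d) (by linarith) k).ne'
    have p2 := (poch_pos (a := a + 2 - d + (b + 1)) (by linarith) k).ne'
    have p3 := (Real.Gamma_pos_of_pos (s := a + 2 - d + (b + 1)) (by linarith)).ne'
    have p4 : (1 - d) ≠ 0 := by linarith
    have p5 : (k + 1 - d : ℝ) ≠ 0 := by linarith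
    have hr' : poch (1 - d) k = (1 - d) * poch (2 - d) k / (k + 1 - d) := by
      rw [eq_div_iff p5, ← hr]; ring
    rw [hr']
    have : (k.factorial : ℝ) ≠ 0 := by positivity
    field_simp
  · exact mul_nonneg (mul_nonneg (div_nonneg (poch_nonneg h0 k) (by positivity))
      (one_div_nonneg.mpr (by linarith))) hB.le

noncomputable def Kf (d x2 x3 x4 : ℝ) : ENNReal :=
  pw (-d) (1 - x2) * pw (-d) (1 - x3) * pw (-d) (x2 - x4) * pw (-d) x3 * pw (-d) x4 *
    (pw 0 (x2 - x3) * pw 0 (x3 - x4))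

lemma K_add (d : ℝ) : (∫⁻ x2, ∫⁻ x3, ∫⁻ x4, Kf d x2 x3 x4) + IB d = IA d := by
  have s : ∀ x2, ∫⁻ x3, ∫⁻ x4, Kf d x2 x3 x4 = ∫⁻ x4, ∫⁻ x3, Kf d x2 x3 x4 := by
    intro x2
    rw [lintegral_lintegral_swap (by unfold Kf; fun_prop)]
  simp_rw [s]
  unfold IA IB
  rw [← lintegral_add_right _ (by fun_prop)]
  congr 1; ext x2
  rw [← lintegral_add_right _ (by fun_prop)]
  congr 1; ext x4
  by_cases h : 0 < x2 - x4
  · unfold bt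
    rw [← lintegral_const_mul _ (by fun_prop), ← lintegral_const_mul _ (by fun_prop),
      ← lintegral_add_right _ (by fun_prop)]
    apply lintegral_congr_ae
    have : ∀ᵐ t : ℝ, t ≠ x4 := by simp [ae_iff]
    filter_upwards [this] with t ht
    have key : pw 0 (x2 - t) * pw 0 (t - x4) + pw 0 (x4 - t) = pw 0 (x2 - t) := by
      rcases lt_or_gt_of_ne ht with h' | h'
      · simp [pw, h', show t < x2 by linarith, h'.not_gt]
      · by_cases h2 : t < x2
        · simp [pw, h', h2, h'.not_gt]
        · simp [pw, h2, h'.not_gt]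
    rw [← key, Kf]
    ring
  · have : pw (-d) (x2 - x4) = 0 := pw_of_nonpos (not_lt.mp h)
    simp [Kf, this]

noncomputable def Gf (d y1 y2 y3 y4 y5 : ℝ) : ENNReal :=
  pw (-d) (y1 - y2) * pw (-d) (y1 - y3) * pw (-d) (y2 - y4) * pw (-d) (y3 - y5) * pw (-d) (y4 - y5) *
    (pw 0 (y2 - y3) * pw 0 (y3 - y4) * (pw 0 y5 * pw 0 (1 - y1)))

lemma Gf_zero {d y1 y2 y3 y4 y5 : ℝ}
    (h : ¬ (0 < y5 ∧ y5 < y4 ∧ y4 < y3 ∧ y3 < y2 ∧ y2 < y1 ∧ y1 < 1)) :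
    Gf d y1 y2 y3 y4 y5 = 0 := by
  by_contra hne
  apply h
  unfold Gf at hne
  have hp : ∀ a t, pw a t ≠ 0 → 0 < t := fun a t h => by
    by_contra h'; exact h (pw_of_nonpos (not_lt.mp h'))
  simp only [mul_ne_zero_iff] at hne
  obtain ⟨⟨⟨⟨⟨a1, a2⟩, a3⟩, a4⟩, a5⟩, ⟨⟨a6, a7⟩, a8, a9⟩⟩ := hne
  have := hp _ _ a1
  have := hp _ _ a5
  have := hp _ _ a6
  have := hp _ _ a7
  have := hp _ _ a8
  have := hp _ _ a9
  refine ⟨?_, ?_, ?_, ?_, ?_, ?_⟩ <;> linarith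

lemma scale3 (d y1 y5 : ℝ) : ∫⁻ y2, ∫⁻ y3, ∫⁻ y4, Gf d y1 y2 y3 y4 y5 =
    pw 0 y5 * pw 0 (1 - y1) * pw (3 - 5 * d) (y1 - y5) * ∫⁻ x2, ∫⁻ x3, ∫⁻ x4, Kf d x2 x3 x4 := by
  by_cases h : 0 < y1 - y5
  · have e : ∀ x2 x3 x4, Gf d y1 (y5 + (y1 - y5) * x2) (y5 + (y1 - y5) * x3)
        (y5 + (y1 - y5) * x4) y5 =
        (pw 0 y5 * pw 0 (1 - y1) * pw (-d + -d + -d + -d + -d + 0 + 0) (y1 - y5)) *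
          Kf d x2 x3 x4 := by
      intro x2 x3 x4
      unfold Gf Kf
      rw [show y1 - (y5 + (y1 - y5) * x2) = (y1 - y5) * (1 - x2) by ring,
        show y1 - (y5 + (y1 - y5) * x3) = (y1 - y5) * (1 - x3) by ring,
        show y5 + (y1 - y5) * x2 - (y5 + (y1 - y5) * x4) = (y1 - y5) * (x2 - x4) by ring,
        show y5 + (y1 - y5) * x2 - (y5 + (y1 - y5) * x3) = (y1 - y5) * (x2 - x3) by ring,
        show y5 + (y1 - y5) * x3 - (y5 + (y1 - y5) * x4) = (y1 - y5) * (x3 - x4) by ring,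
        show y5 + (y1 - y5) * x3 - y5 = (y1 - y5) * x3 by ring,
        show y5 + (y1 - y5) * x4 - y5 = (y1 - y5) * x4 by ring]
      simp only [pw_scale _ h, ← pw_mul]
      ring
    have hc : pw 0 y5 * pw 0 (1 - y1) * pw (-d + -d + -d + -d + -d + 0 + 0) (y1 - y5) ≠ ⊤ :=
      ENNReal.mul_ne_top (ENNReal.mul_ne_top (pw_ne_top _ _) (pw_ne_top _ _)) (pw_ne_top _ _)
    rw [lint_affine _ (by unfold Gf; fun_prop) y5 h]
    have e2 : ∀ x2, ∫⁻ y3, ∫⁻ y4, Gf d y1 (y5 + (y1 - y5) * x2) y3 y4 y5 =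
        ENNReal.ofReal (y1 - y5) * (ENNReal.ofReal (y1 - y5) *
        ((pw 0 y5 * pw 0 (1 - y1) * pw (-d + -d + -d + -d + -d + 0 + 0) (y1 - y5)) *
          ∫⁻ x3, ∫⁻ x4, Kf d x2 x3 x4)) := by
      intro x2
      rw [lint_affine _ (by unfold Gf; fun_prop) y5 h]
      congr 1
      rw [← lintegral_const_mul' _ _ hc, ← lintegral_const_mul' _ _ (by simp)]
      congr 1; ext x3
      rw [lint_affine _ (by unfold Gf; fun_prop) y5 h]
      congr 1
      rw [← lintegral_const_mul' _ _ hc]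
      congr 1; ext x4
      exact e x2 x3 x4
    simp_rw [e2]
    rw [lintegral_const_mul' _ _ (by simp), lintegral_const_mul' _ _ (by simp),
      lintegral_const_mul' _ _ hc]
    have h3 : pw (3 - 5 * d) (y1 - y5) = ENNReal.ofReal (y1 - y5) * ENNReal.ofReal (y1 - y5) *
        ENNReal.ofReal (y1 - y5) * pw (-d + -d + -d + -d + -d + 0 + 0) (y1 - y5) := by
      have : ENNReal.ofReal (y1 - y5) = pw 1 (y1 - y5) := by rw [pw_of_pos h, Real.rpow_one]
      rw [this, pw_mul, pw_mul, pw_mul]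
      congr 1; ring
    rw [h3]
    ring
  · rw [pw_of_nonpos (not_lt.mp h)]
    have : ∀ y2 y3 y4, Gf d y1 y2 y3 y4 y5 = 0 := by
      intro y2 y3 y4
      apply Gf_zero
      rintro ⟨_, _, _, _, _, _⟩
      linarith
    simp [this]

lemma total {d : ℝ} (h1 : d < 1/2) :
    ∫⁻ y1, ∫⁻ y2, ∫⁻ y3, ∫⁻ y4, ∫⁻ y5, Gf d y1 y2 y3 y4 y5 =
    ENNReal.ofReal (1 / (4 - 5 * d)) * ENNReal.ofReal (1 / (5 - 5 * d)) *
      ∫⁻ x2, ∫⁻ x3, ∫⁻ x4, Kf d x2 x3 x4 := by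
  have e : ∀ y1, ∫⁻ y2, ∫⁻ y3, ∫⁻ y4, ∫⁻ y5, Gf d y1 y2 y3 y4 y5 =
      ∫⁻ y5, ∫⁻ y2, ∫⁻ y3, ∫⁻ y4, Gf d y1 y2 y3 y4 y5 := by
    intro y1
    have e3 : ∀ y2 y3, ∫⁻ y4, ∫⁻ y5, Gf d y1 y2 y3 y4 y5 = ∫⁻ y5, ∫⁻ y4, Gf d y1 y2 y3 y4 y5 :=
      fun y2 y3 => lintegral_lintegral_swap (by unfold Gf; fun_prop)
    have e2 : ∀ y2, ∫⁻ y3, ∫⁻ y4, ∫⁻ y5, Gf d y1 y2 y3 y4 y5 =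
        ∫⁻ y5, ∫⁻ y3, ∫⁻ y4, Gf d y1 y2 y3 y4 y5 := by
      intro y2
      rw [lintegral_congr (e3 y2)]
      exact lintegral_lintegral_swap (by unfold Gf; fun_prop)
    rw [lintegral_congr e2]
    exact lintegral_lintegral_swap (by unfold Gf; fun_prop)
  simp_rw [e, scale3]
  have e1 : ∀ y1, ∫⁻ y5, pw 0 y5 * pw 0 (1 - y1) * pw (3 - 5 * d) (y1 - y5) *
      ∫⁻ x2, ∫⁻ x3, ∫⁻ x4, Kf d x2 x3 x4 = 
      ENNReal.ofReal (1 / (4 - 5 * d)) * (pw (4 - 5 * d) y1 * pw 0 (1 - y1)) *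
        ∫⁻ x2, ∫⁻ x3, ∫⁻ x4, Kf d x2 x3 x4 := by
    intro y1
    rw [lintegral_mul_const _ (by fun_prop)]
    congr 1
    have : ∀ y5, pw 0 y5 * pw 0 (1 - y1) * pw (3 - 5 * d) (y1 - y5) =
      pw 0 (1 - y1) * (pw 0 (y5 - 0) * pw (3 - 5 * d) (y1 - y5)) := by
        intro y5; rw [sub_zero]; ring
    simp_rw [this]
    rw [lintegral_const_mul' _ _ (pw_ne_top _ _), lint_conv (by norm_num) (by linarith), zero_add,
      beta_one_left (by linarith), sub_zero, show 0 + (3 - 5 * d) + 1 = 4 - 5 * d by ring,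
      show 3 - 5 * d + 1 = 4 - 5 * d by ring]
    ring
  simp_rw [e1]
  rw [lintegral_mul_const _ (by fun_prop), lintegral_const_mul' _ _ (by simp),
    lint_beta (by linarith) (by norm_num), zero_add, beta_one (by linarith),
    show 4 - 5 * d + 1 = 5 - 5 * d by ring]

lemma lhs_eq (d : ℝ)
    (hfin : ∫⁻ y1, ∫⁻ y2, ∫⁻ y3, ∫⁻ y4, ∫⁻ y5, Gf d y1 y2 y3 y4 y5 ≠ ⊤) :
    (∫ y1 in (0:ℝ)..1, ∫ y2 in (0:ℝ)..y1, ∫ y3 in (0:ℝ)..y2, ∫ y4 in (0:ℝ)..y3, ∫ y5 in (0:ℝ)..y4,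
      (y1 - y2) ^ (-d) * (y1 - y3) ^ (-d) * (y2 - y4) ^ (-d) * (y3 - y5) ^ (-d) * (y4 - y5) ^ (-d)) =
    (∫⁻ y1, ∫⁻ y2, ∫⁻ y3, ∫⁻ y4, ∫⁻ y5, Gf d y1 y2 y3 y4 y5).toReal := by
  refine step zero_le_one (by unfold Gf; fun_prop) ?_ hfin ?_
  · intro y1 hx
    have : ∀ y2 y3 y4 y5, Gf d y1 y2 y3 y4 y5 = 0 := by
      intro y2 y3 y4 y5
      apply Gf_zero
      rintro ⟨_, _, _, _, _, _⟩
      exact hx ⟨by linarith, by linarith⟩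
    simp [this]
  intro y1 ⟨a1, b1⟩ hfin1
  refine step a1.le (by unfold Gf; fun_prop) ?_ hfin1 ?_
  · intro y2 hx
    have : ∀ y3 y4 y5, Gf d y1 y2 y3 y4 y5 = 0 := by
      intro y3 y4 y5
      apply Gf_zero
      rintro ⟨_, _, _, _, _, _⟩
      exact hx ⟨by linarith, by linarith⟩
    simp [this]
  intro y2 ⟨a2, b2⟩ hfin2
  refine step a2.le (by unfold Gf; fun_prop) ?_ hfin2 ?_
  · intro y3 hx
    have : ∀ y4 y5, Gf d y1 y2 y3 y4 y5 = 0 := by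
      intro y4 y5
      apply Gf_zero
      rintro ⟨_, _, _, _, _, _⟩
      exact hx ⟨by linarith, by linarith⟩
    simp [this]
  intro y3 ⟨a3, b3⟩ hfin3
  refine step a3.le (by unfold Gf; fun_prop) ?_ hfin3 ?_
  · intro y4 hx
    have : ∀ y5, Gf d y1 y2 y3 y4 y5 = 0 := by
      intro y5
      apply Gf_zero
      rintro ⟨_, _, _, _, _, _⟩
      exact hx ⟨by linarith, by linarith⟩
    simp [this]
  intro y4 ⟨a4, b4⟩ hfin4
  refine step a4.le (by unfold Gf; fun_prop) ?_ hfin4 ?_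
  · intro y5 hx
    apply Gf_zero
    rintro ⟨_, _, _, _, _, _⟩
    exact hx ⟨by linarith, by linarith⟩
  intro y5 ⟨a5, b5⟩ _
  have c1 : 0 < y1 - y2 := by linarith
  have c2 : 0 < y1 - y3 := by linarith
  have c3 : 0 < y2 - y4 := by linarith
  have c4 : 0 < y3 - y5 := by linarith
  have c5 : 0 < y4 - y5 := by linarith
  have c6 : 0 < y2 - y3 := by linarith
  have c7 : 0 < y3 - y4 := by linarith
  have c8 : 0 < 1 - y1 := by linarith
  unfold Gf
  rw [pw_of_pos c1, pw_of_pos c2, pw_of_pos c3, pw_of_pos c4, pw_of_pos c5, pw_of_pos c6,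
    pw_of_pos c7, pw_of_pos c8, pw_of_pos a5]
  simp only [ENNReal.toReal_mul, Real.rpow_zero, ENNReal.ofReal_one, ENNReal.toReal_one, mul_one]
  rw [ENNReal.toReal_ofReal (by positivity), ENNReal.toReal_ofReal (by positivity),
    ENNReal.toReal_ofReal (by positivity), ENNReal.toReal_ofReal (by positivity),
    ENNReal.toReal_ofReal (by positivity)]

theorem stmt8 (d : ℝ) (h0 : 0 ≤ d) (h1 : d < 1/2) :
    (∫ y1 in (0:ℝ)..1, ∫ y2 in (0:ℝ)..y1, ∫ y3 in (0:ℝ)..y2, ∫ y4 in (0:ℝ)..y3, ∫ y5 in (0:ℝ)..y4,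
      (y1 - y2) ^ (-d) * (y1 - y3) ^ (-d) * (y2 - y4) ^ (-d) * (y3 - y5) ^ (-d) * (y4 - y5) ^ (-d)) =
    Gamma (1-d) ^ 3 / ((1-d) * Gamma (2-2*d)) * (Gamma (4-5*d) / Gamma (4-4*d)) *
      (Gamma (3-3*d) / Gamma (6-5*d)) * F32 d (1-d) (3-3*d) (2-d) (4-4*d) -
      Gamma (1-d) ^ 2 / (1-d) * (Gamma (4-5*d) * Gamma (2-2*d) / (Gamma (6-5*d) * Gamma (4-4*d))) *
      F32 d (1-d) (2-2*d) (2-d) (4-4*d) := by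
  have hA : IA d ≠ ⊤ := by
    rw [IA_eq h1]
    exact ENNReal.mul_ne_top (by simp) (lint_bt_ne_top h1 (by linarith) (by linarith))
  have hK := K_add d
  have hKfin : ∫⁻ x2, ∫⁻ x3, ∫⁻ x4, Kf d x2 x3 x4 ≠ ⊤ :=
    ne_top_of_le_ne_top hA (hK ▸ le_self_add)
  have hB : IB d ≠ ⊤ := ne_top_of_le_ne_top hA (hK ▸ le_add_self)
  have hKr : (∫⁻ x2, ∫⁻ x3, ∫⁻ x4, Kf d x2 x3 x4).toReal = (IA d).toReal - (IB d).toReal := by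
    rw [← hK, ENNReal.toReal_add hKfin hB]; ring
  have hT := total h1
  have hTfin : ∫⁻ y1, ∫⁻ y2, ∫⁻ y3, ∫⁻ y4, ∫⁻ y5, Gf d y1 y2 y3 y4 y5 ≠ ⊤ := by
    rw [hT]; exact ENNReal.mul_ne_top (ENNReal.mul_ne_top (by simp) (by simp)) hKfin
  rw [lhs_eq d hTfin, hT, ENNReal.toReal_mul, ENNReal.toReal_mul, hKr, IA_eq h1, IB_eq h1,
    ENNReal.toReal_mul, ENNReal.toReal_mul, lint_bt_real h0 h1 (by linarith) (by linarith),
    lint_bt_real h0 h1 (by linarith) (by linarith),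
    ENNReal.toReal_ofReal (one_div_nonneg.mpr (by linarith)),
    ENNReal.toReal_ofReal (one_div_nonneg.mpr (by linarith)),
    ENNReal.toReal_ofReal (ProbabilityTheory.beta_pos (by linarith) (by linarith)).le,
    ProbabilityTheory.beta]
  rw [show 1 - 2 * d + 2 - d = 3 - 3 * d by ring, show 3 - 3 * d + (-d + 1) = 4 - 4 * d by ring,
    show -d + 2 - d = 2 - 2 * d by ring, show 2 - 2 * d + (1 - 2 * d + 1) = 4 - 4 * d by ring,
    show -d + 1 = 1 - d by ring, show 1 - 2 * d + 1 = 2 - 2 * d by ring,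
    show 1 - d + (1 - d) = 2 - 2 * d by ring]
  have g6 : Gamma (6 - 5 * d) = (5 - 5 * d) * ((4 - 5 * d) * Gamma (4 - 5 * d)) := by
    rw [← Real.Gamma_add_one (by linarith), show 4 - 5 * d + 1 = 5 - 5 * d by ring,
      ← Real.Gamma_add_one (by linarith), show 5 - 5 * d + 1 = 6 - 5 * d by ring]
  rw [g6]
  have p1 := (Real.Gamma_pos_of_pos (s := 4 - 5 * d) (by linarith)).ne'
  have p2 := (Real.Gamma_pos_of_pos (s := 4 - 4 * d) (by linarith)).ne'
  have p3 := (Real.Gamma_pos_of_pos (s := 2 - 2 * d) (by linarith)).ne'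
  have p4 : 4 - 5 * d ≠ 0 := by linarith
  have p5 : 5 - 5 * d ≠ 0 := by linarith
  have p6 : 1 - d ≠ 0 := by linarith
  generalize F32 d (1 - d) (3 - 3 * d) (2 - d) (4 - 4 * d) = X
  generalize F32 d (1 - d) (2 - 2 * d) (2 - d) (4 - 4 * d) = Y
  generalize Gamma (4 - 5 * d) = a at *
  generalize Gamma (4 - 4 * d) = b at *
  generalize Gamma (2 - 2 * d) = c at *
  generalize Gamma (3 - 3 * d) = e at *
  generalize Gamma (1 - d) = f at *
  generalize 4 - 5 * d = u at *
  generalize 5 - 5 * d = v at *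
  generalize 1 - d = w at *
  field_simp
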